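/- Let R ∈ (0,1), ∂⊥ ∈ (0,1), and ω ∈ (0, 0.16). Let (C_j)_{j≥1} be a sequence of [n_j, k_j] linear binary codes with generator matrices G_j, with n_j strictly increasing, k_j/n_j → R, and d(C_j⊥)/n_j → ∂⊥ (where d(C_j⊥) is the dual distance). Let (Z_j)_{j≥1} be any sequence of random vectors, Z_j on F_2^{n_j}. Then there exists a sequence of vectors e_j ∈ F_2^{n_j} with |e_j|/n_j → ω such that: (i) if the sequence d_TV(P_{G_j Z_j}, U_{k_j}) is negligible in k_j, then the sequence |bias(e_j·Z_j)| is negligible in k_j; and (ii) if d_TV(P_{G_j Z_j}, U_{k_j}) = 2^{−Ω(k_j)}, then |bias(e_j·Z_j)| = 2^{−Ω(k_j)}. -/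

import Mathlib

open Finset Filter
open scoped Classical BigOperators Topology

abbrev BV (n : ℕ) := Fin n → ZMod 2

def wt {n : ℕ} (x : BV n) : ℕ := (Finset.univ.filter (fun i => x i ≠ 0)).card

def dotp {n : ℕ} (x y : BV n) : ZMod 2 := ∑ i, x i * y i

def IsPMF {α : Type*} [Fintype α] (P : α → ℝ) : Prop :=
  (∀ x, 0 ≤ P x) ∧ ∑ x, P x = 1

noncomputable def dTV {α : Type*} [Fintype α] (P Q : α → ℝ) : ℝ :=
  (1/2) * ∑ x, |P x - Q x|

noncomputable def unif (α : Type*) [Fintype α] : α → ℝ := fun _ => 1 / (Fintype.card α)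

noncomputable def unifOn {α : Type*} [Fintype α] (S : Set α) : α → ℝ :=
  fun x => if x ∈ S then 1 / (Nat.card S) else 0

noncomputable def conv {n : ℕ} (P Q : BV n → ℝ) : BV n → ℝ :=
  fun x => ∑ y, P y * Q (x - y)

noncomputable def FT {n : ℕ} (f : BV n → ℝ) : BV n → ℝ :=
  fun y => (1 / 2^n) * ∑ x, f x * (if dotp x y = 0 then (1:ℝ) else -1)

noncomputable def Kraw (n w i : ℕ) : ℝ :=
  ∑ j ∈ Finset.range (w+1), (-1:ℝ)^j * (Nat.choose i j) * (Nat.choose (n-i) (w-j))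

def Vball (n t : ℕ) : ℕ := ∑ j ∈ Finset.range (t+1), Nat.choose n j

noncomputable def pmfMap {m n : ℕ} (G : Matrix (Fin m) (Fin n) (ZMod 2)) (P : BV n → ℝ) :
    BV m → ℝ :=
  fun u => ∑ z ∈ Finset.univ.filter (fun z => G.mulVec z = u), P z

noncomputable def biasOf {n : ℕ} (e : BV n) (P : BV n → ℝ) : ℝ :=
  1/2 - ∑ z ∈ Finset.univ.filter (fun z => dotp e z = 1), P z

noncomputable def bitPMF {n : ℕ} (e : BV n) (P : BV n → ℝ) : ZMod 2 → ℝ :=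
  fun b => ∑ z ∈ Finset.univ.filter (fun z => dotp e z = b), P z

noncomputable def jointPMF {m n : ℕ} (G : Matrix (Fin m) (Fin n) (ZMod 2)) (e : BV n)
    (P : BV n → ℝ) : BV m × ZMod 2 → ℝ :=
  fun p => ∑ z ∈ Finset.univ.filter (fun z => G.mulVec z = p.1 ∧ dotp e z = p.2), P z

noncomputable def prodPMF {m : ℕ} (Pb : ZMod 2 → ℝ) : BV m × ZMod 2 → ℝ :=
  fun p => (1 / 2^m) * Pb p.2

def dualSet {n : ℕ} (C : Set (BV n)) : Set (BV n) := {y | ∀ c ∈ C, dotp y c = 0}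

def rowSpan {k n : ℕ} (G : Matrix (Fin k) (Fin n) (ZMod 2)) : Submodule (ZMod 2) (BV n) :=
  Submodule.span (ZMod 2) (Set.range (fun i => G i))

def Negl (f : ℕ → ℝ) (k : ℕ → ℕ) : Prop :=
  ∀ a : ℝ, 0 < a → Tendsto (fun j => f j * (k j : ℝ) ^ a) atTop (nhds 0)

def ExpSmall (f : ℕ → ℝ) (k : ℕ → ℕ) : Prop :=
  ∃ β : ℝ, 0 < β ∧ ∀ᶠ j in atTop, f j ≤ (2 : ℝ) ^ (-(β * (k j : ℝ)))

/-- The nontrivial real character of `ZMod 2`. -/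
noncomputable def signChar (b : ZMod 2) : ℝ := if b = 0 then 1 else -1

/-- The pmf of a vector of `n` independent Bernoulli(`p`) bits. -/
noncomputable def bernoulliVec {n : ℕ} (p : ℝ) (e : BV n) : ℝ :=
  ∏ i, if e i = 0 then 1 - p else p

lemma zmod_two_cases (b : ZMod 2) : b = 0 ∨ b = 1 := by
  revert b; decide

lemma sum_zmod_two (f : ZMod 2 → ℝ) : ∑ b, f b = f 0 + f 1 := Fin.sum_univ_two f

lemma signChar_add (a b : ZMod 2) : signChar (a + b) = signChar a * signChar b := by
  rcases zmod_two_cases a with rfl | rfl <;> rcases zmod_two_cases b with rfl | rfl <;>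
    simp [signChar, show (1 : ZMod 2) + 1 = 0 from rfl]

lemma signChar_sum {ι : Type*} (s : Finset ι) (f : ι → ZMod 2) :
    signChar (∑ i ∈ s, f i) = ∏ i ∈ s, signChar (f i) := by
  induction s using Finset.induction_on with
  | empty => simp [signChar]
  | insert a s ha ih => rw [Finset.sum_insert ha, Finset.prod_insert ha, signChar_add, ih]

lemma sum_prod_bits {n : ℕ} (F : Fin n → ZMod 2 → ℝ) :
    ∑ e : BV n, ∏ i, F i (e i) = ∏ i, (F i 0 + F i 1) := by
  simp_rw [← sum_zmod_two]
  exact (Fintype.prod_sum F).symm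

lemma prod_ite_wt {n : ℕ} (s : ℝ) (x : BV n) : ∏ i, (if x i = 0 then 1 else s) = s ^ wt x := by
  rw [Finset.prod_ite]
  simp [wt]

lemma sum_pow_wt {n : ℕ} (s : ℝ) : ∑ x : BV n, s ^ wt x = (1 + s) ^ n := by
  simp_rw [← prod_ite_wt]
  rw [sum_prod_bits (fun _ b => if b = 0 then 1 else s)]
  simp

lemma bernoulliVec_pos {n : ℕ} {p : ℝ} (h0 : 0 < p) (h1 : p < 1) (e : BV n) :
    0 < bernoulliVec p e := by
  refine Finset.prod_pos fun i _ => ?_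
  split_ifs <;> linarith

lemma sum_bernoulliVec {n : ℕ} (p : ℝ) : ∑ e : BV n, bernoulliVec p e = 1 := by
  unfold bernoulliVec
  rw [sum_prod_bits (fun _ b => if b = 0 then 1 - p else p)]
  simp

lemma sum_bernoulliVec_mul_signChar {n : ℕ} (p : ℝ) (y : BV n) :
    ∑ e : BV n, bernoulliVec p e * signChar (dotp e y) = (1 - 2 * p) ^ wt y := by
  unfold bernoulliVec dotp
  simp_rw [signChar_sum, ← Finset.prod_mul_distrib]
  rw [sum_prod_bits (fun i b => (if b = 0 then 1 - p else p) * signChar (b * y i)),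
    ← prod_ite_wt]
  refine Finset.prod_congr rfl fun i _ => ?_
  by_cases h : y i = 0
  · simp [h, signChar]
  · simp [h, signChar]; ring

lemma wt_sub_eq_sum {n : ℕ} (p : ℝ) (e : BV n) :
    (wt e : ℝ) - p * n = ∑ i, ((if e i = 0 then 0 else 1) - p) := by
  rw [Finset.sum_sub_distrib]
  simp [wt, Finset.sum_ite, mul_comm]

lemma sum_bernoulliVec_mul_sq_wt_sub_le {n : ℕ} {p : ℝ} (h0 : 0 < p) (h1 : p < 1) :
    ∑ e : BV n, bernoulliVec p e * ((wt e : ℝ) - p * n) ^ 2 ≤ n := by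
  set g : ZMod 2 → ℝ := fun b => (if b = 0 then 0 else 1) - p with hg
  have hcross : ∀ i l : Fin n,
      ∑ e : BV n, bernoulliVec p e * (g (e i) * g (e l)) ≤ if i = l then 1 else 0 := by
    intro i l
    split_ifs with hil
    · subst hil
      rw [← sum_bernoulliVec (n := n) p]
      refine Finset.sum_le_sum fun e _ => mul_le_of_le_one_right (bernoulliVec_pos h0 h1 e).le ?_
      simp only [hg]
      split_ifs <;> nlinarith
    · have hprod : ∀ e : BV n, bernoulliVec p e * (g (e i) * g (e l)) =
          ∏ m, ((if e m = 0 then 1 - p else p) *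
            ((if m = i then g (e m) else 1) * (if m = l then g (e m) else 1))) := by
        intro e
        rw [Finset.prod_mul_distrib, Finset.prod_mul_distrib, Finset.prod_ite_eq' _ i,
          Finset.prod_ite_eq' _ l, if_pos (Finset.mem_univ i), if_pos (Finset.mem_univ l),
          bernoulliVec]
      simp_rw [hprod]
      rw [sum_prod_bits (fun m b => (if b = 0 then 1 - p else p) *
            ((if m = i then g b else 1) * (if m = l then g b else 1)))]
      refine (Finset.prod_eq_zero (Finset.mem_univ i) ?_).le
      simp [hil, hg]
      ring
  calc ∑ e : BV n, bernoulliVec p e * ((wt e : ℝ) - p * n) ^ 2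
      = ∑ i : Fin n, ∑ l : Fin n, ∑ e : BV n, bernoulliVec p e * (g (e i) * g (e l)) := by
        simp_rw [wt_sub_eq_sum, sq, Finset.sum_mul_sum, Finset.mul_sum]
        rw [Finset.sum_comm]
        exact Finset.sum_congr rfl fun i _ => Finset.sum_comm
    _ ≤ ∑ i : Fin n, ∑ l : Fin n, if i = l then (1 : ℝ) else 0 :=
        Finset.sum_le_sum fun i _ => Finset.sum_le_sum fun l _ => hcross i l
    _ = n := by simp

lemma dTV_nonneg {α : Type*} [Fintype α] (P Q : α → ℝ) : 0 ≤ dTV P Q :=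
  mul_nonneg (by norm_num) (Finset.sum_nonneg fun _ _ => abs_nonneg _)

lemma sum_le_card_mul_add_dTV {m : ℕ} (Q : BV m → ℝ) (B : Finset (BV m)) :
    ∑ u ∈ B, Q u ≤ B.card / 2 ^ m + 2 * dTV Q (unif (BV m)) := by
  have hU : ∑ u ∈ B, unif (BV m) u = B.card / 2 ^ m := by
    simp [unif, div_eq_mul_inv]
  have hdiff : ∑ u ∈ B, (Q u - unif (BV m) u) ≤ 2 * dTV Q (unif (BV m)) :=
    calc ∑ u ∈ B, (Q u - unif (BV m) u) ≤ ∑ u ∈ B, |Q u - unif (BV m) u| :=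
          Finset.sum_le_sum fun _ _ => le_abs_self _
      _ ≤ ∑ u, |Q u - unif (BV m) u| :=
          Finset.sum_le_sum_of_subset_of_nonneg (Finset.subset_univ _) fun _ _ _ => abs_nonneg _
      _ = 2 * dTV Q (unif (BV m)) := by unfold dTV; ring
  rw [Finset.sum_sub_distrib] at hdiff
  linarith

lemma sum_le_sum_pmfMap_image {m n : ℕ} (G : Matrix (Fin m) (Fin n) (ZMod 2)) {P : BV n → ℝ}
    (hP : ∀ z, 0 ≤ P z) (A : Finset (BV n)) :
    ∑ z ∈ A, P z ≤ ∑ u ∈ A.image G.mulVec, pmfMap G P u := by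
  rw [← Finset.sum_fiberwise_of_maps_to (fun z hz => Finset.mem_image_of_mem G.mulVec hz)]
  refine Finset.sum_le_sum fun u _ => ?_
  exact Finset.sum_le_sum_of_subset_of_nonneg
    (Finset.filter_subset_filter _ (Finset.subset_univ _)) fun _ _ _ => hP _

lemma card_ball_le {n : ℕ} (x : BV n) {s : ℝ} (hs0 : 0 < s) (hs1 : s < 1) (t : ℝ) :
    ((Finset.univ.filter fun z : BV n => (wt (z + x) : ℝ) ≤ t).card : ℝ) ≤
      (1 + s) ^ n * s ^ (-t) := by
  have hsum : ∑ z : BV n, s ^ wt (z + x) = (1 + s) ^ n := by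
    rw [← sum_pow_wt]
    exact Equiv.sum_comp (Equiv.addRight x) fun z => s ^ wt z
  rw [← hsum, Finset.card_eq_sum_ones, Nat.cast_sum, Finset.sum_mul]
  refine le_trans (Finset.sum_le_sum fun z hz => ?_)
    (Finset.sum_le_sum_of_subset_of_nonneg (Finset.subset_univ _) fun z _ _ => by positivity)
  rw [Finset.mem_filter] at hz
  rw [← Real.rpow_natCast, ← Real.rpow_add hs0]
  push_cast
  exact Real.one_le_rpow_of_pos_of_le_one_of_nonpos hs0 hs1.le (by linarith [hz.2])

/-- Since few vectors lie in a ball of radius `t`, a vector with near-uniform image under `G` is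
unlikely to lie in one, so the exponential moment of its distance to any point is small. -/
lemma sum_mul_pow_wt_add_le {m n : ℕ} (G : Matrix (Fin m) (Fin n) (ZMod 2)) {P : BV n → ℝ}
    (hP : IsPMF P) (x : BV n) {r s : ℝ} (hr0 : 0 < r) (hr1 : r < 1) (hs0 : 0 < s) (hs1 : s < 1)
    (t : ℝ) :
    ∑ z, P z * r ^ wt (z + x) ≤
      r ^ t + (1 + s) ^ n * s ^ (-t) / 2 ^ m + 2 * dTV (pmfMap G P) (unif (BV m)) := by
  set A := Finset.univ.filter fun z : BV n => (wt (z + x) : ℝ) ≤ t with hA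
  have hsplit : ∑ z, P z * r ^ wt (z + x) ≤ r ^ t + ∑ z ∈ A, P z := by
    calc ∑ z, P z * r ^ wt (z + x)
        ≤ ∑ z, (P z * r ^ t + if (wt (z + x) : ℝ) ≤ t then P z else 0) := by
          refine Finset.sum_le_sum fun z _ => ?_
          have hz := hP.1 z
          have ht : 0 ≤ P z * r ^ t := by positivity
          split_ifs with h
          · linarith [mul_le_of_le_one_right hz (pow_le_one₀ (n := wt (z + x)) hr0.le hr1.le)]
          · rw [add_zero, ← Real.rpow_natCast]
            exact mul_le_mul_of_nonneg_left
              (Real.rpow_le_rpow_of_exponent_ge hr0 hr1.le (not_le.mp h).le) hz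
      _ = r ^ t + ∑ z ∈ A, P z := by
          rw [Finset.sum_add_distrib, ← Finset.sum_mul, hP.2, one_mul, hA, Finset.sum_filter]
  have himg := sum_le_sum_pmfMap_image G hP.1 A
  have hball := sum_le_card_mul_add_dTV (pmfMap G P) (A.image G.mulVec)
  have hcard : ((A.image G.mulVec).card : ℝ) / 2 ^ m ≤ (1 + s) ^ n * s ^ (-t) / 2 ^ m := by
    gcongr
    exact le_trans (by exact_mod_cast Finset.card_image_le) (card_ball_le x hs0 hs1 t)
  linarith

lemma two_mul_biasOf {n : ℕ} (e : BV n) {P : BV n → ℝ} (hP : IsPMF P) :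
    2 * biasOf e P = ∑ z, P z * signChar (dotp e z) := by
  have hterm : ∀ z, P z * signChar (dotp e z) = P z - 2 * if dotp e z = 1 then P z else 0 := by
    intro z
    rcases zmod_two_cases (dotp e z) with h | h
    · simp [h, signChar]
    · simp [h, signChar]; ring
  simp_rw [hterm]
  rw [Finset.sum_sub_distrib, ← Finset.mul_sum, hP.2, biasOf, Finset.sum_filter]
  ring

lemma dotp_add {n : ℕ} (e x y : BV n) : dotp e (x + y) = dotp e x + dotp e y := by
  simp [dotp, mul_add, Finset.sum_add_distrib]

lemma sum_bernoulliVec_mul_sq_biasOf {n : ℕ} (p : ℝ) {P : BV n → ℝ} (hP : IsPMF P) :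
    ∑ e : BV n, bernoulliVec p e * (2 * biasOf e P) ^ 2 =
      ∑ x, P x * ∑ z, P z * (1 - 2 * p) ^ wt (z + x) := by
  simp_rw [two_mul_biasOf _ hP, ← sum_bernoulliVec_mul_signChar, sq, Finset.sum_mul_sum,
    Finset.mul_sum]
  rw [Finset.sum_comm]
  refine Finset.sum_congr rfl fun x _ => ?_
  rw [Finset.sum_comm]
  refine Finset.sum_congr rfl fun z _ => Finset.sum_congr rfl fun e _ => ?_
  rw [dotp_add, signChar_add]
  ring

lemma exists_small_bias {m n : ℕ} (hn : 0 < n) (G : Matrix (Fin m) (Fin n) (ZMod 2))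
    {P : BV n → ℝ} (hP : IsPMF P) {p s : ℝ} (hp0 : 0 < p) (hp1 : p < 1 / 2) (hs0 : 0 < s)
    (hs1 : s < 1) (t : ℝ) :
    ∃ e : BV n, ((wt e : ℝ) - p * n) ^ 2 ≤ 2 * n ∧
      biasOf e P ^ 2 ≤ ((1 - 2 * p) ^ t + (1 + s) ^ n * s ^ (-t) / 2 ^ m) / 2 +
        dTV (pmfMap G P) (unif (BV m)) := by
  set E := (1 - 2 * p) ^ t + (1 + s) ^ n * s ^ (-t) / 2 ^ m +
    2 * dTV (pmfMap G P) (unif (BV m)) with hE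
  have hr0 : 0 < 1 - 2 * p := by linarith
  have hEpos : 0 < E := by
    have := dTV_nonneg (pmfMap G P) (unif (BV m))
    positivity
  have hn' : (0 : ℝ) < n := by exact_mod_cast hn
  have hbias : ∑ e : BV n, bernoulliVec p e * (2 * biasOf e P) ^ 2 ≤ E := by
    rw [sum_bernoulliVec_mul_sq_biasOf p hP]
    calc ∑ x, P x * ∑ z, P z * (1 - 2 * p) ^ wt (z + x) ≤ ∑ x, P x * E :=
          Finset.sum_le_sum fun x _ => mul_le_mul_of_nonneg_left
            (sum_mul_pow_wt_add_le G hP x hr0 (by linarith) hs0 hs1 t) (hP.1 x)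
      _ = E := by rw [← Finset.sum_mul, hP.2, one_mul]
  have hwt := sum_bernoulliVec_mul_sq_wt_sub_le (n := n) hp0 (by linarith : p < 1)
  have hsum : ∑ e : BV n, bernoulliVec p e *
        ((2 * biasOf e P) ^ 2 / E + ((wt e : ℝ) - p * n) ^ 2 / n) ≤
      ∑ e : BV n, bernoulliVec p e * 2 := by
    rw [← Finset.sum_mul, sum_bernoulliVec, one_mul]
    simp_rw [mul_add, ← mul_div_assoc]
    rw [Finset.sum_add_distrib, ← Finset.sum_div, ← Finset.sum_div]
    have h1 := (div_le_one hEpos).mpr hbias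
    have h2 := (div_le_one hn').mpr hwt
    linarith
  obtain ⟨e, -, he⟩ := Finset.exists_le_of_sum_le Finset.univ_nonempty hsum
  replace he := le_of_mul_le_mul_left he (bernoulliVec_pos hp0 (by linarith) e)
  have h1 : 0 ≤ (2 * biasOf e P) ^ 2 / E := by positivity
  have h2 : 0 ≤ ((wt e : ℝ) - p * n) ^ 2 / n := by positivity
  have h3 := (div_le_iff₀ hEpos).mp (by linarith : (2 * biasOf e P) ^ 2 / E ≤ 2)
  have h4 := (div_le_iff₀ hn').mp (by linarith : ((wt e : ℝ) - p * n) ^ 2 / n ≤ 2)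
  exact ⟨e, h4, by linarith⟩

/-- Constants for which the error terms of `exists_small_bias` at `t = δ * n` decay
exponentially in the length. -/
lemma exists_exponents {R r : ℝ} (hR : R ∈ Set.Ioo (0 : ℝ) 1) (hr0 : 0 < r) (hr1 : r < 1) :
    ∃ s δ c : ℝ, 0 < s ∧ s < 1 ∧ 0 < c ∧ ∀ n k : ℕ, 3 / 4 * R * n ≤ k →
      (r ^ (δ * n) + (1 + s) ^ n * s ^ (-(δ * n)) / 2 ^ k) / 2 ≤ (2 : ℝ) ^ (-(c * n)) := by
  obtain ⟨hR0, hR1⟩ := hR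
  set s : ℝ := 2 ^ (R / 4) - 1 with hs
  have hs0 : 0 < s := by
    linarith [Real.one_lt_rpow (by norm_num : (1 : ℝ) < 2) (by linarith : 0 < R / 4)]
  have hs1 : s < 1 := by
    have := Real.rpow_lt_rpow_of_exponent_lt (by norm_num : (1 : ℝ) < 2)
      (by linarith : R / 4 < 1)
    rw [Real.rpow_one] at this
    linarith
  set b := -Real.logb 2 s with hb
  have hb0 : 0 < b := neg_pos.mpr (Real.logb_neg (by norm_num) hs0 hs1)
  set a := -Real.logb 2 r with ha
  have ha0 : 0 < a := neg_pos.mpr (Real.logb_neg (by norm_num) hr0 hr1)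
  have hsb : s = 2 ^ (-b) := by
    rw [hb, neg_neg, Real.rpow_logb (by norm_num) (by norm_num) hs0]
  have hra : r = 2 ^ (-a) := by
    rw [ha, neg_neg, Real.rpow_logb (by norm_num) (by norm_num) hr0]
  set δ := R / (4 * b) with hδ
  have hδ0 : 0 < δ := by positivity
  refine ⟨s, δ, min (a * δ) (R / 4), hs0, hs1, lt_min (by positivity) (by positivity), ?_⟩
  intro n k hk
  have h1 : r ^ (δ * n) ≤ (2 : ℝ) ^ (-(min (a * δ) (R / 4) * n)) := by
    rw [hra, ← Real.rpow_mul (by norm_num)]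
    refine Real.rpow_le_rpow_of_exponent_le (by norm_num) ?_
    have := mul_le_mul_of_nonneg_right (min_le_left (a * δ) (R / 4)) (Nat.cast_nonneg (α := ℝ) n)
    linarith
  have h2 : (1 + s) ^ n * s ^ (-(δ * n)) / 2 ^ k ≤
      (2 : ℝ) ^ (-(min (a * δ) (R / 4) * n)) := by
    have e1 : (1 + s) ^ n = (2 : ℝ) ^ (R / 4 * n) := by
      rw [hs, add_sub_cancel, Real.rpow_mul (by norm_num), Real.rpow_natCast]
    have e2 : s ^ (-(δ * n)) = (2 : ℝ) ^ (R / 4 * n) := by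
      rw [hsb, ← Real.rpow_mul (by norm_num), hδ]
      congr 1
      field_simp
    rw [e1, e2, ← Real.rpow_add (by norm_num), ← Real.rpow_natCast,
      ← Real.rpow_sub (by norm_num)]
    refine Real.rpow_le_rpow_of_exponent_le (by norm_num) ?_
    have := mul_le_mul_of_nonneg_right (min_le_right (a * δ) (R / 4)) (Nat.cast_nonneg (α := ℝ) n)
    linarith
  linarith

lemma negl_two_rpow {c : ℝ} (hc : 0 < c) {k : ℕ → ℕ} (hk : Tendsto k atTop atTop) :
    Negl (fun j => (2 : ℝ) ^ (-(c * k j))) k := by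
  intro a _
  have h := (tendsto_rpow_mul_exp_neg_mul_atTop_nhds_zero a (Real.log 2 * c)
    (mul_pos (Real.log_pos (by norm_num)) hc)).comp (tendsto_natCast_atTop_atTop.comp hk)
  refine h.congr fun j => ?_
  simp only [Function.comp]
  rw [Real.rpow_def_of_pos (by norm_num : (0 : ℝ) < 2), mul_comm]
  congr 2
  ring

lemma negl_of_sq_le {f g h : ℕ → ℝ} {k : ℕ → ℕ} (hle : ∀ᶠ j in atTop, f j ^ 2 ≤ g j + h j)
    (hg : Negl g k) (hh : Negl h k) : Negl (fun j => |f j|) k := by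
  intro a ha
  have hlim := ((hg (2 * a) (by positivity)).add (hh (2 * a) (by positivity))).sqrt
  rw [add_zero, Real.sqrt_zero] at hlim
  refine squeeze_zero' (Eventually.of_forall fun j => by positivity) ?_ hlim
  filter_upwards [hle] with j hj
  refine Real.le_sqrt_of_sq_le ?_
  have hpow : ((k j : ℝ) ^ a) ^ 2 = (k j : ℝ) ^ (2 * a) := by
    rw [← Real.rpow_natCast, ← Real.rpow_mul (Nat.cast_nonneg _), mul_comm]
    norm_num
  rw [mul_pow, sq_abs, hpow, ← add_mul]
  exact mul_le_mul_of_nonneg_right hj (by positivity)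

lemma expSmall_of_sq_le {f g : ℕ → ℝ} {k : ℕ → ℕ} (hk : Tendsto k atTop atTop) {c : ℝ}
    (hc : 0 < c) (hle : ∀ᶠ j in atTop, f j ^ 2 ≤ (2 : ℝ) ^ (-(c * k j)) + g j)
    (hg : ExpSmall g k) : ExpSmall (fun j => |f j|) k := by
  obtain ⟨β, hβ, hgβ⟩ := hg
  set γ := min c β with hγ
  have hγ0 : 0 < γ := lt_min hc hβ
  refine ⟨γ / 4, by positivity, ?_⟩
  have hlarge := (tendsto_natCast_atTop_atTop (R := ℝ)).comp hk |>.eventually_ge_atTop (2 / γ)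
  filter_upwards [hle, hgβ, hlarge] with j hj hgj hkj
  have hkγ : 2 ≤ γ * k j := by
    rw [mul_comm]
    exact (div_le_iff₀ hγ0).mp hkj
  have hmono : ∀ x, γ ≤ x → (2 : ℝ) ^ (-(x * k j)) ≤ 2 ^ (-(γ * k j)) := fun x hx =>
    Real.rpow_le_rpow_of_exponent_le (by norm_num)
      (neg_le_neg (mul_le_mul_of_nonneg_right hx (Nat.cast_nonneg _)))
  have h2 : 2 * (2 : ℝ) ^ (-(γ * k j)) ≤ (2 ^ (-(γ / 4 * k j))) ^ 2 := by
    rw [← Real.rpow_natCast, ← Real.rpow_mul (by norm_num)]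
    nth_rewrite 1 [← Real.rpow_one 2]
    rw [← Real.rpow_add (by norm_num)]
    refine Real.rpow_le_rpow_of_exponent_le (by norm_num) ?_
    push_cast
    linarith
  refine abs_le_of_sq_le_sq ?_ (by positivity)
  linarith [hmono c (min_le_left _ _), hmono β (min_le_right _ _)]

lemma tendsto_wt_div {n : ℕ → ℕ} (hn : Tendsto n atTop atTop) {p : ℝ} (e : ∀ j, BV (n j))
    (he : ∀ᶠ j in atTop, ((wt (e j) : ℝ) - p * n j) ^ 2 ≤ 2 * n j) :
    Tendsto (fun j => (wt (e j) : ℝ) / n j) atTop (𝓝 p) := by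
  have hlim : Tendsto (fun j => √(2 / (n j : ℝ))) atTop (𝓝 0) := by
    have := ((tendsto_natCast_atTop_atTop (R := ℝ)).comp hn).const_div_atTop 2 |>.sqrt
    simpa using this
  rw [tendsto_iff_dist_tendsto_zero]
  refine squeeze_zero' (Eventually.of_forall fun j => dist_nonneg) ?_ hlim
  filter_upwards [he, hn.eventually_gt_atTop 0] with j hj hnj
  have hnj' : (0 : ℝ) < n j := by exact_mod_cast hnj
  rw [Real.dist_eq]
  refine Real.le_sqrt_of_sq_le ?_
  rw [sq_abs, div_sub' hnj'.ne', div_pow, div_le_div_iff₀ (by positivity) hnj']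
  nlinarith

theorem no_meaningful_reduction_positive_rate (R dlim omega : ℝ)
    (hR : R ∈ Set.Ioo (0 : ℝ) 1) (hdlim : dlim ∈ Set.Ioo (0 : ℝ) 1)
    (homega : omega ∈ Set.Ioo (0 : ℝ) 0.16)
    (n k : ℕ → ℕ) (hmono : StrictMono n)
    (G : ∀ j, Matrix (Fin (k j)) (Fin (n j)) (ZMod 2))
    (hrank : ∀ j, (G j).rank = k j)
    (d : ℕ → ℕ)
    (hdual : ∀ j, IsLeast
      {m : ℕ | ∃ y ∈ dualSet ((rowSpan (G j) : Submodule (ZMod 2) (BV (n j))) : Set (BV (n j))),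
        y ≠ 0 ∧ wt y = m} (d j))
    (hkR : Tendsto (fun j => (k j : ℝ) / (n j : ℝ)) atTop (nhds R))
    (hdl : Tendsto (fun j => (d j : ℝ) / (n j : ℝ)) atTop (nhds dlim))
    (P : ∀ j, BV (n j) → ℝ) (hP : ∀ j, IsPMF (P j)) :
    ∃ e : ∀ j, BV (n j),
      Tendsto (fun j => (wt (e j) : ℝ) / (n j : ℝ)) atTop (nhds omega) ∧
      (Negl (fun j => dTV (pmfMap (G j) (P j)) (unif (BV (k j)))) k →
        Negl (fun j => |biasOf (e j) (P j)|) k) ∧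
      (ExpSmall (fun j => dTV (pmfMap (G j) (P j)) (unif (BV (k j)))) k →
        ExpSmall (fun j => |biasOf (e j) (P j)|) k) := by
  obtain ⟨hω0, hω1⟩ := homega
  have hω2 : omega < 1 / 2 := by norm_num at hω1 ⊢; linarith
  obtain ⟨s, δ, c, hs0, hs1, hc, hexp⟩ :=
    exists_exponents hR (by linarith : 0 < 1 - 2 * omega) (by linarith)
  have hn := hmono.tendsto_atTop
  have hkn : ∀ᶠ j in atTop, 3 / 4 * R * n j ≤ k j := by
    filter_upwards [hkR.eventually_const_le (by linarith [hR.1] : 3 / 4 * R < R),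
      hn.eventually_gt_atTop 0] with j hj hnj
    exact (le_div_iff₀ (by exact_mod_cast hnj)).mp hj
  have hk : Tendsto k atTop atTop := by
    rw [← tendsto_natCast_atTop_iff (R := ℝ)]
    refine tendsto_atTop_mono' _ hkn ?_
    exact ((tendsto_natCast_atTop_atTop (R := ℝ)).comp hn).const_mul_atTop
      (by linarith [hR.1] : 0 < 3 / 4 * R)
  have hex : ∀ᶠ j in atTop, ∃ e : BV (n j), ((wt e : ℝ) - omega * n j) ^ 2 ≤ 2 * n j ∧
      biasOf e (P j) ^ 2 ≤ (2 : ℝ) ^ (-(c * k j)) +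
        dTV (pmfMap (G j) (P j)) (unif (BV (k j))) := by
    filter_upwards [hkn, hn.eventually_gt_atTop 0] with j hkj hnj
    obtain ⟨e, hwt, hbias⟩ :=
      exists_small_bias hnj (G j) (hP j) hω0 hω2 hs0 hs1 (δ * n j)
    refine ⟨e, hwt, hbias.trans (add_le_add_left ((hexp _ _ hkj).trans ?_) _)⟩
    have hle : (k j : ℝ) ≤ n j := by
      exact_mod_cast hrank j ▸ (G j).rank_le_width
    exact Real.rpow_le_rpow_of_exponent_le (by norm_num)
      (neg_le_neg (mul_le_mul_of_nonneg_left hle hc.le))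
  obtain ⟨e, he⟩ : ∃ e : ∀ j, BV (n j), ∀ᶠ j in atTop,
      ((wt (e j) : ℝ) - omega * n j) ^ 2 ≤ 2 * n j ∧
      biasOf (e j) (P j) ^ 2 ≤ (2 : ℝ) ^ (-(c * k j)) +
        dTV (pmfMap (G j) (P j)) (unif (BV (k j))) :=
    ⟨fun j => Classical.epsilon _, hex.mono fun j hj => Classical.epsilon_spec hj⟩
  have hbias := he.mono fun j hj => hj.2
  exact ⟨e, tendsto_wt_div hn e (he.mono fun j hj => hj.1),
    negl_of_sq_le hbias (negl_two_rpow hc hk), expSmall_of_sq_le hk hc hbias⟩
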